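/- There is an absolute constant C > 0 such that for every t > 0 and all Schwartz functions f, g, h on ℝ, one has sup_{ξ ∈ ℝ} |𝒢_t[f,g,h](ξ)| ≤ C t^{−6/5} ‖⟨x⟩f‖_{L²(ℝ)} ‖⟨x⟩g‖_{L²(ℝ)} ‖⟨x⟩h‖_{L²(ℝ)}. -/

import Mathlib

noncomputable section
open MeasureTheory Complex Real Filter Set ENNReal

/-- 1D Fourier transform with convention `(2π)^{-1/2} ∫ e^{-ixξ} f(x) dx`. -/
def ft (f : ℝ → ℂ) (ξ : ℝ) : ℂ :=
  (((2 * π) ^ (-(1:ℝ)/2) : ℝ) : ℂ) * ∫ x : ℝ, Complex.exp (-(Complex.I * x * ξ)) * f x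

/-- 1D inverse Fourier transform. -/
def ift (f : ℝ → ℂ) (x : ℝ) : ℂ :=
  (((2 * π) ^ (-(1:ℝ)/2) : ℝ) : ℂ) * ∫ ξ : ℝ, Complex.exp (Complex.I * x * ξ) * f ξ

/-- The Schrödinger group `e^{itΔ} f = 𝓕⁻¹ (e^{-itξ²} 𝓕 f)`. -/
def schrodinger (t : ℝ) (f : ℝ → ℂ) : ℝ → ℂ :=
  ift fun ξ => Complex.exp (-(Complex.I * t * ξ ^ 2)) * ft f ξ

/-- Japanese bracket `⟨x⟩ = (1+x²)^{1/2}`. -/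
def jb (x : ℝ) : ℝ := Real.sqrt (1 + x ^ 2)

/-- Inverse Fourier transform on `ℝ²` with convention `(2π)^{-1} ∫ e^{ip·q} G(q) dq`. -/
def ift2 (G : ℝ × ℝ → ℂ) (p : ℝ × ℝ) : ℂ :=
  (((2 * π)⁻¹ : ℝ) : ℂ) * ∫ q : ℝ × ℝ, Complex.exp (Complex.I * (p.1 * q.1 + p.2 * q.2)) * G q

/-- The trilinear kernel `G_ξ[f,g,h](η,σ) = f̂(ξ-η) (ḡ)^(η-ξ+σ) ĥ(ξ-σ)`. -/
def Gker (f g h : ℝ → ℂ) (ξ : ℝ) (p : ℝ × ℝ) : ℂ :=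
  ft f (ξ - p.1) * ft (fun x => (starRingEnd ℂ) (g x)) (p.1 - ξ + p.2) * ft h (ξ - p.2)

/-- The trilinear remainder `𝒢_t[f,g,h](ξ)`. -/
def calG (t : ℝ) (f g h : ℝ → ℂ) (ξ : ℝ) : ℂ :=
  (((2 * t)⁻¹ : ℝ) : ℂ) *
    ∫ p : ℝ × ℝ,
      (Complex.exp (-(Complex.I * p.1 * p.2 / (2 * t))) - 1) * ift2 (Gker f g h ξ) p


open scoped FourierTransform SchwartzMap

lemma ft_eq_fourier (f : ℝ → ℂ) (ξ : ℝ) :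
    ft f ξ = (((2 * π) ^ (-(1:ℝ)/2) : ℝ) : ℂ) * 𝓕 f ((2 * π)⁻¹ * ξ) := by
  rw [ft, Real.fourier_eq']
  congr 1
  refine integral_congr_ae (Eventually.of_forall fun x => ?_)
  simp only [smul_eq_mul, RCLike.inner_apply, conj_trivial]
  congr 2
  push_cast
  have : (π : ℂ) ≠ 0 := by exact_mod_cast Real.pi_ne_zero
  field_simp

lemma integrable_ft (f : 𝓢(ℝ, ℂ)) : Integrable (ft f) := by
  have h : ft f = fun ξ => (((2 * π) ^ (-(1:ℝ)/2) : ℝ) : ℂ) * (𝓕 f) ((2 * π)⁻¹ * ξ) :=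
    funext fun ξ => ft_eq_fourier f ξ
  rw [h]
  exact (((𝓕 f).integrable).comp_mul_left' (by positivity)).const_mul _

/-- Fourier inversion for Schwartz functions. -/
lemma ift_ft (f : 𝓢(ℝ, ℂ)) (x : ℝ) : ift (ft f) x = f x := by
  have hinv : 𝓕⁻ (𝓕 (f : ℝ → ℂ)) x = f x :=
    congrFun (f.continuous.fourierInv_fourier_eq f.integrable (𝓕 f).integrable) x
  rw [Real.fourierInv_eq'] at hinv
  have hscale := Measure.integral_comp_mul_left (fun v : ℝ =>
    Complex.exp ((2 * π * inner ℝ v x : ℝ) * Complex.I) • 𝓕 (f : ℝ → ℂ) v) (2 * π)⁻¹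
  rw [hinv, inv_inv, abs_of_pos (by positivity)] at hscale
  have hc : (((2 * π) ^ (-(1:ℝ)/2) : ℝ) : ℂ) * (((2 * π) ^ (-(1:ℝ)/2) : ℝ) : ℂ)
      * ((2 * π : ℝ) : ℂ) = 1 := by
    rw [← Complex.ofReal_mul, ← Real.rpow_add (by positivity), ← Complex.ofReal_mul,
      ← Real.rpow_add_one (by positivity)]
    norm_num
  calc ift (ft f) x
      = (((2 * π) ^ (-(1:ℝ)/2) : ℝ) : ℂ) * ((((2 * π) ^ (-(1:ℝ)/2) : ℝ) : ℂ) *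
          ∫ v : ℝ, Complex.exp ((2 * π * inner ℝ ((2 * π)⁻¹ * v) x : ℝ) * Complex.I) •
            𝓕 (f : ℝ → ℂ) ((2 * π)⁻¹ * v)) := by
        rw [ift]
        congr 1
        rw [← integral_const_mul]
        refine integral_congr_ae (Eventually.of_forall fun v => ?_)
        simp only [smul_eq_mul, RCLike.inner_apply, conj_trivial, ft_eq_fourier]
        rw [mul_left_comm]
        congr 3
        push_cast
        have : (π : ℂ) ≠ 0 := by exact_mod_cast Real.pi_ne_zero
        field_simp
    _ = f x := by
        rw [hscale, Complex.real_smul]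
        linear_combination (f x) * hc

lemma norm_cexp_I_mul_ofReal (r : ℝ) : ‖Complex.exp (Complex.I * r)‖ = 1 := by
  rw [mul_comm, Complex.norm_exp_ofReal_mul_I]

/-- The inverse Fourier transform of the trilinear kernel in physical variables. -/
lemma ift2_Gker (f g h : 𝓢(ℝ, ℂ)) (ξ : ℝ) (p : ℝ × ℝ) :
    ift2 (Gker f g h ξ) p = (((2 * π) ^ (-(1:ℝ)/2) : ℝ) : ℂ) *
      ∫ x : ℝ, Complex.exp (Complex.I * (ξ * (p.1 + p.2 - x) : ℝ)) *
        (f (x - p.1) * (starRingEnd ℂ) (g x) * h (x - p.2)) := by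
  obtain ⟨y, z⟩ := p
  set c : ℂ := (((2 * π) ^ (-(1:ℝ)/2) : ℝ) : ℂ) with hc
  have hcc : (((2 * π)⁻¹ : ℝ) : ℂ) = c * c := by
    rw [hc, ← Complex.ofReal_mul, ← Real.rpow_add (by positivity)]
    norm_num [Real.rpow_neg_one]
  let Φ : ℝ × ℝ → ℝ → ℂ := fun q x =>
    Complex.exp (Complex.I * (y * (ξ - q.1) + z * (ξ - q.2) - x * (ξ - q.1 - q.2) : ℝ)) *
      (ft f q.1 * ft h q.2 * (starRingEnd ℂ) (g x))
  have hΦ : Integrable (Function.uncurry Φ) (volume.prod volume) := by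
    have hg : Integrable (fun x => (starRingEnd ℂ) (g x)) :=
      (Complex.conjCLE.toContinuousLinearMap).integrable_comp g.integrable
    have hprod := ((integrable_ft f).mul_prod (integrable_ft h)).mul_prod hg
    refine hprod.bdd_mul (c := 1) ?_ (Eventually.of_forall fun r => ?_)
    · exact (by fun_prop : Continuous fun r : (ℝ × ℝ) × ℝ => Complex.exp (Complex.I *
        (y * (ξ - r.1.1) + z * (ξ - r.1.2) - r.2 * (ξ - r.1.1 - r.1.2) : ℝ))).aestronglyMeasurable
    · exact (norm_cexp_I_mul_ofReal _).le
  have hleft : ∫ q : ℝ × ℝ, Complex.exp (Complex.I * (y * q.1 + z * q.2)) * Gker f g h ξ q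
      = c * ∫ q : ℝ × ℝ, ∫ x : ℝ, Φ q x := by
    rw [← integral_sub_left_eq_self _ _ ((ξ, ξ) : ℝ × ℝ), ← integral_const_mul]
    refine integral_congr_ae (Eventually.of_forall fun q => ?_)
    simp only [Gker, Prod.fst_sub, Prod.snd_sub, Φ, _root_.sub_sub_cancel]
    rw [ft.eq_def (fun x => (starRingEnd ℂ) (g x)), ← hc]
    have : ∀ A B E J : ℂ, E * (A * (c * J) * B) = c * ((E * A * B) * J) := by intros; ring
    rw [this, ← integral_const_mul]
    congr 1
    refine integral_congr_ae (Eventually.of_forall fun x => ?_)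
    have hexp : Complex.exp (Complex.I *
        (y * (ξ - q.1) + z * (ξ - q.2) - x * (ξ - q.1 - q.2) : ℝ)) =
        Complex.exp (Complex.I * (y * ((ξ - q.1 : ℝ) : ℂ) + z * ((ξ - q.2 : ℝ) : ℂ))) *
        Complex.exp (-(Complex.I * x * ((ξ - q.1 - ξ + (ξ - q.2) : ℝ) : ℂ))) := by
      rw [← Complex.exp_add]
      congr 1
      push_cast
      ring
    simp only [hexp]
    ring
  have hinner : ∀ x : ℝ, c * c * ∫ q : ℝ × ℝ, Φ q x =
      Complex.exp (Complex.I * (ξ * (y + z - x) : ℝ)) *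
        (f (x - y) * (starRingEnd ℂ) (g x) * h (x - z)) := by
    intro x
    rw [← ift_ft f, ← ift_ft h, ift, ift, ← hc]
    have : ∀ A B E J : ℂ, E * ((c * A) * J * (c * B)) = c * c * ((E * J) * (A * B)) := by
      intros; ring
    rw [this]
    congr 1
    rw [← integral_prod_mul, ← integral_const_mul]
    refine integral_congr_ae (Eventually.of_forall fun q => ?_)
    have hexp : Complex.exp (Complex.I *
        (y * (ξ - q.1) + z * (ξ - q.2) - x * (ξ - q.1 - q.2) : ℝ)) =
        Complex.exp (Complex.I * (ξ * (y + z - x) : ℝ)) *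
        Complex.exp (Complex.I * (x - y : ℝ) * q.1) *
        Complex.exp (Complex.I * (x - z : ℝ) * q.2) := by
      rw [← Complex.exp_add, ← Complex.exp_add]
      congr 1
      push_cast
      ring
    simp only [Φ, hexp]
    ring
  rw [ift2, hleft, integral_integral_swap hΦ, hcc, ← mul_assoc, mul_comm (c * c) c, mul_assoc]
  congr 1
  rw [← integral_const_mul]
  exact integral_congr_ae (Eventually.of_forall hinner)

lemma jb_pos (x : ℝ) : 0 < jb x := Real.sqrt_pos.2 (by positivity)

lemma one_le_jb (x : ℝ) : 1 ≤ jb x := Real.one_le_sqrt.2 (by nlinarith [sq_nonneg x])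

lemma continuous_jb : Continuous jb := by unfold jb; fun_prop

lemma abs_sub_le_jb_mul_jb (x u : ℝ) : |x - u| ≤ jb x * jb u := by
  rw [jb, jb, ← Real.sqrt_mul (by positivity)]
  exact Real.abs_le_sqrt (by nlinarith [sq_nonneg (1 + x * u)])

lemma norm_cexp_sub_one_le_rpow (s : ℝ) {θ : ℝ} (hθ₀ : 0 ≤ θ) (hθ₁ : θ ≤ 1) :
    ‖Complex.exp (Complex.I * s) - 1‖ ≤ 2 * |s| ^ θ := by
  rcases le_or_gt |s| 1 with hs | hs
  · have h₁ : ‖Complex.exp (Complex.I * s) - 1‖ ≤ |s| :=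
      Real.norm_exp_I_mul_ofReal_sub_one_le
    have h₂ : |s| ≤ |s| ^ θ := Real.self_le_rpow_of_le_one (abs_nonneg s) hs hθ₁
    linarith [abs_nonneg s]
  · have h₁ : ‖Complex.exp (Complex.I * s) - 1‖ ≤ 2 := by
      refine (norm_sub_le _ _).trans ?_
      rw [norm_cexp_I_mul_ofReal, norm_one]
      norm_num
    linarith [Real.one_le_rpow hs.le hθ₀]

/-- The integrand of the weighted `L¹` norm, with weight `⟨x⟩^{2/5}`. -/
def weightedAbs (f : ℝ → ℂ) (x : ℝ) : ℝ≥0∞ := ENNReal.ofReal (jb x ^ (2/5 : ℝ) * ‖f x‖)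

lemma measurable_weightedAbs {f : ℝ → ℂ} (hf : Continuous f) : Measurable (weightedAbs f) := by
  unfold weightedAbs
  refine ENNReal.measurable_ofReal.comp (Measurable.mul ?_ hf.norm.measurable)
  exact continuous_jb.measurable.pow_const _

/-- The `L²` norm of `⟨x⟩^{-3/5}`. -/
def bracketConst : ℝ≥0∞ := (∫⁻ x : ℝ, ENNReal.ofReal (jb x ^ (-(3/5) : ℝ)) ^ (2:ℝ)) ^ (1/2 : ℝ)

lemma bracketConst_ne_top : bracketConst ≠ ∞ := by
  refine ENNReal.rpow_ne_top_of_nonneg (by norm_num) ?_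
  have hint := integrable_rpow_neg_one_add_norm_sq (E := ℝ) (μ := volume) (r := 6/5)
    (by norm_num)
  convert hint.lintegral_lt_top.ne using 3 with x
  rw [ENNReal.ofReal_rpow_of_nonneg (by have := jb_pos x; positivity) (by norm_num),
    ← Real.rpow_mul (jb_pos x).le, jb, Real.sqrt_eq_rpow, ← Real.rpow_mul (by positivity),
    Real.norm_eq_abs, sq_abs]
  norm_num

lemma lintegral_weightedAbs_le {f : ℝ → ℂ} (hf : Continuous f) :
    ∫⁻ x, weightedAbs f x ≤
      bracketConst * eLpNorm (fun x => (jb x : ℂ) * f x) 2 volume := by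
  have hjb : Continuous fun x => (jb x : ℂ) * f x :=
    (Complex.continuous_ofReal.comp continuous_jb).mul hf
  rw [eLpNorm_eq_lintegral_rpow_enorm_toReal (by norm_num) (by norm_num)]
  refine le_trans (le_of_eq ?_) (ENNReal.lintegral_mul_le_Lp_mul_Lq volume
    (Real.HolderConjugate.two_two) (f := fun x => ENNReal.ofReal (jb x ^ (-(3/5) : ℝ)))
    (g := fun x => ‖(jb x : ℂ) * f x‖ₑ) ?_ hjb.enorm.measurable.aemeasurable)
  · refine lintegral_congr fun x => ?_
    simp only [Pi.mul_apply]
    rw [weightedAbs, ← ofReal_norm, ← ENNReal.ofReal_mul (by have := jb_pos x; positivity),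
      norm_mul, Complex.norm_real, Real.norm_of_nonneg (jb_pos x).le, ← mul_assoc,
      ← Real.rpow_add_one (jb_pos x).ne']
    norm_num
  · exact (ENNReal.measurable_ofReal.comp (continuous_jb.measurable.pow_const _)).aemeasurable

lemma eLpNorm_jb_mul_ne_top (f : 𝓢(ℝ, ℂ)) :
    eLpNorm (fun x => (jb x : ℂ) * f x) 2 volume ≠ ∞ := by
  have h := ((SchwartzMap.smulLeftCLM ℂ (fun x : ℝ => (1 + ‖x‖ ^ 2) ^ (1/2 : ℝ)) f).memLp 2
    volume).eLpNorm_ne_top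
  rw [SchwartzMap.smulLeftCLM_apply (Function.hasTemperateGrowth_one_add_norm_sq_rpow ℝ _)] at h
  simpa [jb, Real.sqrt_eq_rpow] using h

lemma lintegral_lintegral_translates {F G H : ℝ → ℝ≥0∞} (hF : Measurable F) (hG : Measurable G)
    (hH : Measurable H) :
    ∫⁻ p : ℝ × ℝ, ∫⁻ x : ℝ, F (x - p.1) * G x * H (x - p.2) =
      (∫⁻ x, F x) * (∫⁻ x, G x) * ∫⁻ x, H x := by
  rw [lintegral_lintegral_swap (by fun_prop)]
  have : ∀ x : ℝ, ∫⁻ p : ℝ × ℝ, F (x - p.1) * G x * H (x - p.2) =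
      (∫⁻ x, F x) * (∫⁻ x, H x) * G x := by
    intro x
    have h := lintegral_prod_mul (μ := (volume : Measure ℝ)) (ν := (volume : Measure ℝ))
      (f := fun y => F (x - y)) (g := fun y => H (x - y)) (by fun_prop) (by fun_prop)
    rw [lintegral_sub_left_eq_self F, lintegral_sub_left_eq_self H] at h
    rw [← h, ← lintegral_mul_const _ (by fun_prop)]
    exact lintegral_congr fun p => by ring
  simp_rw [this]
  rw [lintegral_const_mul _ hG]
  ring

lemma abs_rpow_mul_abs_rpow_le (x y z : ℝ) :
    |y| ^ (1/5 : ℝ) * |z| ^ (1/5 : ℝ) ≤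
      jb (x - y) ^ (2/5 : ℝ) * jb x ^ (2/5 : ℝ) * jb (x - z) ^ (2/5 : ℝ) := by
  have key : ∀ u : ℝ, |u| ^ (1/5 : ℝ) ≤ jb x ^ (1/5 : ℝ) * jb (x - u) ^ (2/5 : ℝ) := by
    intro u
    have h := abs_sub_le_jb_mul_jb x (x - u)
    rw [_root_.sub_sub_cancel] at h
    calc |u| ^ (1/5 : ℝ) ≤ (jb x * jb (x - u)) ^ (1/5 : ℝ) :=
          Real.rpow_le_rpow (abs_nonneg u) h (by norm_num)
      _ = jb x ^ (1/5 : ℝ) * jb (x - u) ^ (1/5 : ℝ) :=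
          Real.mul_rpow (jb_pos _).le (jb_pos _).le
      _ ≤ _ := mul_le_mul_of_nonneg_left
          (Real.rpow_le_rpow_of_exponent_le (one_le_jb _) (by norm_num))
          (Real.rpow_nonneg (jb_pos _).le _)
  have hx : jb x ^ (2/5 : ℝ) = jb x ^ (1/5 : ℝ) * jb x ^ (1/5 : ℝ) := by
    rw [← Real.rpow_add (jb_pos x)]
    norm_num
  rw [hx]
  refine (mul_le_mul (key y) (key z) (by positivity)
    ((Real.rpow_nonneg (abs_nonneg y) _).trans (key y))).trans (le_of_eq ?_)
  ring

lemma norm_phase_sub_one_le {t : ℝ} (ht : 0 < t) (y z : ℝ) :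
    ‖Complex.exp (-(Complex.I * y * z / (2 * t))) - 1‖ ≤
      2 * (2 * t) ^ (-(1/5) : ℝ) * (|y| ^ (1/5 : ℝ) * |z| ^ (1/5 : ℝ)) := by
  have harg : -(Complex.I * y * z / (2 * t)) = Complex.I * (-(y * z / (2 * t)) : ℝ) := by
    push_cast
    ring
  rw [harg]
  refine (norm_cexp_sub_one_le_rpow _ (θ := 1/5) (by norm_num) (by norm_num)).trans
    (le_of_eq ?_)
  rw [abs_neg, abs_div, abs_mul, abs_of_pos (by positivity : 0 < 2 * t),
    Real.div_rpow (by positivity) (by positivity),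
    Real.mul_rpow (abs_nonneg _) (abs_nonneg _), Real.rpow_neg (by positivity)]
  ring

lemma enorm_ift2_Gker_le (f g h : 𝓢(ℝ, ℂ)) (ξ : ℝ) (p : ℝ × ℝ) :
    ‖ift2 (Gker f g h ξ) p‖ₑ ≤ ENNReal.ofReal ((2 * π) ^ (-(1:ℝ)/2)) *
      ∫⁻ x : ℝ, ENNReal.ofReal (‖f (x - p.1)‖ * ‖g x‖ * ‖h (x - p.2)‖) := by
  rw [ift2_Gker, enorm_mul]
  refine mul_le_mul' (le_of_eq ?_) ((enorm_integral_le_lintegral_enorm _).trans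
    (le_of_eq (lintegral_congr fun x => ?_)))
  · rw [← ofReal_norm, Complex.norm_real, Real.norm_of_nonneg (by positivity)]
  · rw [← ofReal_norm, norm_mul, norm_cexp_I_mul_ofReal, one_mul, norm_mul, norm_mul,
      RCLike.norm_conj]

lemma enorm_calG_integrand_le {t : ℝ} (ht : 0 < t) (f g h : 𝓢(ℝ, ℂ)) (ξ : ℝ) (p : ℝ × ℝ) :
    ‖(Complex.exp (-(Complex.I * p.1 * p.2 / (2 * t))) - 1) * ift2 (Gker f g h ξ) p‖ₑ ≤
      ENNReal.ofReal (2 * (2 * t) ^ (-(1/5) : ℝ) * (2 * π) ^ (-(1:ℝ)/2)) *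
        ∫⁻ x : ℝ, weightedAbs f (x - p.1) * weightedAbs g x * weightedAbs h (x - p.2) := by
  set A : ℝ := |p.1| ^ (1/5 : ℝ) * |p.2| ^ (1/5 : ℝ) with hA
  have hphase : ‖Complex.exp (-(Complex.I * p.1 * p.2 / (2 * t))) - 1‖ₑ ≤
      ENNReal.ofReal (2 * (2 * t) ^ (-(1/5) : ℝ)) * ENNReal.ofReal A := by
    rw [← ofReal_norm, ← ENNReal.ofReal_mul (by positivity)]
    exact ENNReal.ofReal_le_ofReal (norm_phase_sub_one_le ht p.1 p.2)
  have hweight : ENNReal.ofReal A *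
      ∫⁻ x : ℝ, ENNReal.ofReal (‖f (x - p.1)‖ * ‖g x‖ * ‖h (x - p.2)‖) ≤
      ∫⁻ x : ℝ, weightedAbs f (x - p.1) * weightedAbs g x * weightedAbs h (x - p.2) := by
    rw [← lintegral_const_mul' _ _ ENNReal.ofReal_ne_top]
    refine lintegral_mono fun x => ?_
    have h₁ := jb_pos x
    have h₂ := jb_pos (x - p.1)
    have h₃ := jb_pos (x - p.2)
    simp only [weightedAbs]
    rw [← ENNReal.ofReal_mul (by positivity), ← ENNReal.ofReal_mul (by positivity),
      ← ENNReal.ofReal_mul (by positivity)]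
    refine ENNReal.ofReal_le_ofReal ((mul_le_mul_of_nonneg_right
      (abs_rpow_mul_abs_rpow_le x p.1 p.2) (by positivity)).trans (le_of_eq ?_))
    ring
  rw [enorm_mul, ENNReal.ofReal_mul (by positivity : 0 ≤ 2 * (2 * t) ^ (-(1/5) : ℝ))]
  calc _ ≤ _ := mul_le_mul' hphase (enorm_ift2_Gker_le f g h ξ p)
    _ = ENNReal.ofReal (2 * (2 * t) ^ (-(1/5) : ℝ)) * ENNReal.ofReal ((2 * π) ^ (-(1:ℝ)/2)) *
        (ENNReal.ofReal A *
          ∫⁻ x : ℝ, ENNReal.ofReal (‖f (x - p.1)‖ * ‖g x‖ * ‖h (x - p.2)‖)) := by ring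
    _ ≤ _ := by gcongr

lemma enorm_calG_le {t : ℝ} (ht : 0 < t) (f g h : 𝓢(ℝ, ℂ)) (ξ : ℝ) :
    ‖calG t f g h ξ‖ₑ ≤
      ENNReal.ofReal (2 * (2 * π) ^ (-(1:ℝ)/2) * (2 * t) ^ (-(6:ℝ)/5)) *
        ((bracketConst * eLpNorm (fun x => (jb x : ℂ) * f x) 2 volume) *
          (bracketConst * eLpNorm (fun x => (jb x : ℂ) * g x) 2 volume) *
          (bracketConst * eLpNorm (fun x => (jb x : ℂ) * h x) 2 volume)) := by
  have hpow : (2 * t)⁻¹ * (2 * (2 * t) ^ (-(1/5) : ℝ) * (2 * π) ^ (-(1:ℝ)/2)) =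
      2 * (2 * π) ^ (-(1:ℝ)/2) * (2 * t) ^ (-(6:ℝ)/5) := by
    have : (2 * t) ^ (-(6:ℝ)/5) = (2 * t)⁻¹ * (2 * t) ^ (-(1/5) : ℝ) := by
      rw [← Real.rpow_neg_one, ← Real.rpow_add (by positivity)]
      norm_num
    rw [this]
    ring
  rw [calG, enorm_mul, ← ofReal_norm (((2 * t)⁻¹ : ℝ) : ℂ), Complex.norm_real,
    Real.norm_of_nonneg (by positivity), ← hpow, ENNReal.ofReal_mul (by positivity), mul_assoc]
  gcongr
  calc _ ≤ ∫⁻ p : ℝ × ℝ, _ := enorm_integral_le_lintegral_enorm _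
    _ ≤ _ := lintegral_mono (enorm_calG_integrand_le ht f g h ξ)
    _ = _ := by
      rw [lintegral_const_mul' _ _ ENNReal.ofReal_ne_top,
        lintegral_lintegral_translates (measurable_weightedAbs f.continuous)
          (measurable_weightedAbs g.continuous) (measurable_weightedAbs h.continuous)]
    _ ≤ _ := by
      gcongr
      · exact lintegral_weightedAbs_le f.continuous
      · exact lintegral_weightedAbs_le g.continuous
      · exact lintegral_weightedAbs_le h.continuous

/-- uniform bound on the trilinear remainder `𝒢_t`. -/
theorem calG_uniform_bound :
    ∃ C : ℝ, 0 < C ∧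
      ∀ t : ℝ, 0 < t →
        ∀ f g h : SchwartzMap ℝ ℂ, ∀ ξ : ℝ,
          ‖calG t ⇑f ⇑g ⇑h ξ‖ ≤
            C * t ^ (-(6:ℝ)/5) *
              ((eLpNorm (fun x => (jb x : ℂ) * f x) 2 volume).toReal *
                (eLpNorm (fun x => (jb x : ℂ) * g x) 2 volume).toReal *
                (eLpNorm (fun x => (jb x : ℂ) * h x) 2 volume).toReal) := by
  refine ⟨2 * (2 * π) ^ (-(1:ℝ)/2) * 2 ^ (-(6:ℝ)/5) * bracketConst.toReal ^ 3 + 1,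
    by positivity, fun t ht f g h ξ => ?_⟩
  have hK := bracketConst_ne_top
  have hf := eLpNorm_jb_mul_ne_top f
  have hg := eLpNorm_jb_mul_ne_top g
  have hh := eLpNorm_jb_mul_ne_top h
  have hle := ENNReal.toReal_mono (by finiteness) (enorm_calG_le ht f g h ξ)
  simp only [ENNReal.toReal_mul, toReal_enorm] at hle
  rw [ENNReal.toReal_ofReal (by positivity), Real.mul_rpow (by norm_num) ht.le] at hle
  refine hle.trans (le_trans (le_of_eq ?_) (mul_le_mul_of_nonneg_right
    (mul_le_mul_of_nonneg_right (le_add_of_nonneg_right zero_le_one) (by positivity))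
    (by positivity)))
  ring
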